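/- For every d ≥ 1, every soluble group of derived length at most d satisfies a nontrivial law in F₂ of length at most 4 · 6^{d−1}. -/

import Mathlib

/-- `w` is a law for `G` if the image of `w` under every homomorphism `F₂ → G` is trivial. -/
def IsLaw (G : Type*) [Group G] (w : FreeGroup (Fin 2)) : Prop :=
  ∀ f : FreeGroup (Fin 2) →* G, f w = 1

namespace FreeGroup

variable {α : Type*}

theorem IsReduced.invRev {L : List (α × Bool)} (h : IsReduced L) : IsReduced (invRev L) := by
  rw [IsReduced, FreeGroup.invRev, List.isChain_reverse, List.isChain_map]
  refine h.imp fun a b hab hba => ?_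
  simp only at hba ⊢
  rw [hab hba.symm]

/-- If `L` starts with `x` and ends with `y⁻¹`, then no cancellation occurs in the commutator of
`x * L * x⁻¹` and `y * L * y⁻¹`. -/
theorem isReduced_commutator_conj {M : List (Fin 2 × Bool)}
    (h : IsReduced ((0, true) :: (M ++ [(1, false)]))) :
    IsReduced ((0, true) :: ((((0, true) :: (M ++ [(1, false)])) ++ (0, false) :: (1, true) ::
      ((0, true) :: (M ++ [(1, false)])) ++ (1, false) :: (0, true) ::
      ((1, true) :: (invRev M ++ [(0, false)])) ++ (0, false) :: (1, true) ::
      ((1, true) :: (invRev M ++ [(0, false)]))) ++ [(1, false)])) := by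
  have h' : IsReduced ((1, true) :: (invRev M ++ [(0, false)])) := by
    simpa [invRev] using h.invRev
  simp_all [IsReduced]

theorem exists_reduced_word_mem_derivedSeries (n : ℕ) :
    ∃ M : List (Fin 2 × Bool), IsReduced ((0, true) :: (M ++ [(1, false)])) ∧ 2 ≤ M.length ∧
      M.length + 2 ≤ 4 * 6 ^ n ∧
      mk ((0, true) :: (M ++ [(1, false)])) ∈
        derivedSeries (FreeGroup (Fin 2)) (n + 1) := by
  induction n with
  | zero =>
    refine ⟨[(1, true), (0, false)], by simp, by simp, by simp, ?_⟩
    rw [derivedSeries_succ]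
    exact Subgroup.commutator_mem_commutator (g₁ := of 0) (g₂ := of 1)
      (by simp) (by simp)
  | succ n ih =>
    obtain ⟨M, hM, h2, hlen, hmem⟩ := ih
    refine ⟨_, isReduced_commutator_conj hM, ?_, ?_, ?_⟩
    · simp; omega
    · simp [invRev_length, pow_succ] at *; omega
    · rw [derivedSeries_succ]
      set w := mk ((0, true) :: (M ++ [(1, false)])) with hw
      have hn : (derivedSeries (FreeGroup (Fin 2)) (n + 1)).Normal := inferInstance
      have key := Subgroup.commutator_mem_commutator
        (hn.conj_mem w hmem (of 0)) (hn.conj_mem w hmem (of 1))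
      convert key using 1
      simp [hw, commutatorElement_def, of, inv_mk, mul_mk, invRev]

end FreeGroup

theorem statement4 (d : ℕ) (hd : 1 ≤ d) (G : Type) [Group G]
    (hG : derivedSeries G d = ⊥) :
    ∃ w : FreeGroup (Fin 2), w ≠ 1 ∧ w.toWord.length ≤ 4 * 6 ^ (d - 1) ∧ IsLaw G w := by
  obtain ⟨n, rfl⟩ := Nat.exists_eq_add_of_le' hd
  obtain ⟨M, hM, -, hlen, hmem⟩ := FreeGroup.exists_reduced_word_mem_derivedSeries n
  have hword : (FreeGroup.mk ((0, true) :: (M ++ [(1, false)]))).toWord =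
      (0, true) :: (M ++ [(1, false)]) := by
    rw [FreeGroup.toWord_mk, hM.reduce_eq]
  refine ⟨FreeGroup.mk ((0, true) :: (M ++ [(1, false)])), fun h1 => ?_, ?_, fun f => ?_⟩
  · simp [h1] at hword
  · rw [hword, List.length_cons, List.length_append, List.length_singleton]
    exact hlen
  · have := map_derivedSeries_le_derivedSeries f (n + 1) (Subgroup.mem_map_of_mem f hmem)
    rwa [hG, Subgroup.mem_bot] at this
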